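/- Let f : {-1,1}^n → [-1,1] be a function of degree at most d (with f not constant). Then Var(f)² ≤ d⁴ e^{4d} · max_{1 ≤ j ≤ n} Inf_j(f); equivalently Var(f)² / max_{1 ≤ j ≤ n} Inf_j(f) ≤ d⁴ e^{4d}. -/

import Mathlib

open Finset

/-- The Walsh character `χ_S(x) = ∏_{k ∈ S} x_k` on the Boolean cube `{-1,1}^n`,
where a point of the cube is encoded as `x : Fin n → Bool` (`true ↦ 1`, `false ↦ -1`). -/
noncomputable def walsh {n : ℕ} (S : Finset (Fin n)) (x : Fin n → Bool) : ℝ :=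
  ∏ k ∈ S, (if x k then (1 : ℝ) else -1)

/-- The Fourier–Walsh coefficient `f̂(S) = 2^{-n} ∑_x f(x) χ_S(x)`. -/
noncomputable def walshCoeff {n : ℕ} (f : (Fin n → Bool) → ℝ) (S : Finset (Fin n)) : ℝ :=
  (∑ x : Fin n → Bool, f x * walsh S x) / 2 ^ n

/-- The variance `Var(f) = ∑_{S ≠ ∅} f̂(S)²`. -/
noncomputable def variance {n : ℕ} (f : (Fin n → Bool) → ℝ) : ℝ :=
  ∑ S ∈ Finset.univ.filter (fun S : Finset (Fin n) => S ≠ ∅), (walshCoeff f S) ^ 2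

/-- The influence of coordinate `j`: `Inf_j(f) = ∑_{S ∋ j} f̂(S)²`. -/
noncomputable def influence {n : ℕ} (j : Fin n) (f : (Fin n → Bool) → ℝ) : ℝ :=
  ∑ S ∈ Finset.univ.filter (fun S : Finset (Fin n) => j ∈ S), (walshCoeff f S) ^ 2

open scoped BigOperators

section CubeExpectation

variable {n : ℕ}

/-- The point `x` with its coordinate `a` negated. -/
def flipAt (a : Fin n) (x : Fin n → Bool) : Fin n → Bool :=
  Function.update x a (!x a)

lemma flipAt_involutive (a : Fin n) : Function.Involutive (flipAt a) := by
  intro x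
  simp [flipAt]

lemma walsh_flipAt_of_notMem {a : Fin n} {S : Finset (Fin n)} (ha : a ∉ S) (x : Fin n → Bool) :
    walsh S (flipAt a x) = walsh S x := by
  refine prod_congr rfl fun k hk => ?_
  have hka : k ≠ a := fun h => ha (h ▸ hk)
  simp [flipAt, hka]

lemma walsh_singleton_flipAt (a : Fin n) (x : Fin n → Bool) :
    walsh {a} (flipAt a x) = -walsh {a} x := by
  cases h : x a <;> simp [walsh, flipAt, h]

lemma walsh_singleton_sq (a : Fin n) (x : Fin n → Bool) : walsh {a} x ^ 2 = 1 := by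
  cases h : x a <;> simp [walsh, h]

lemma expect_walsh_singleton_mul {a : Fin n} {q : (Fin n → Bool) → ℝ}
    (hq : ∀ x, q (flipAt a x) = q x) : 𝔼 x, walsh {a} x * q x = 0 := by
  have h : 𝔼 x, walsh {a} (flipAt a x) * q (flipAt a x) = 𝔼 x, walsh {a} x * q x :=
    Fintype.expect_equiv (flipAt_involutive a).toPerm _ _ fun _ => rfl
  simp only [walsh_singleton_flipAt, hq, neg_mul, expect_neg_distrib] at h
  linarith

/-- The Walsh polynomial with coefficients `c`, restricted to the subsets of `T`. -/
noncomputable def walshSum (T : Finset (Fin n)) (c : Finset (Fin n) → ℝ) (x : Fin n → Bool) : ℝ :=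
  ∑ S ∈ T.powerset, c S * walsh S x

lemma walshSum_flipAt {a : Fin n} {T : Finset (Fin n)} (ha : a ∉ T) (c : Finset (Fin n) → ℝ)
    (x : Fin n → Bool) : walshSum T c (flipAt a x) = walshSum T c x := by
  refine sum_congr rfl fun S hS => ?_
  rw [walsh_flipAt_of_notMem fun h => ha (mem_powerset.1 hS h)]

lemma walshSum_insert {a : Fin n} {T : Finset (Fin n)} (ha : a ∉ T) (c : Finset (Fin n) → ℝ)
    (x : Fin n → Bool) :
    walshSum (insert a T) c x =
      walshSum T c x + walsh {a} x * walshSum T (fun S => c (insert a S)) x := by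
  rw [walshSum, sum_powerset_insert ha, walshSum, walshSum, mul_sum]
  congr 1
  refine sum_congr rfl fun S hS => ?_
  have haS : a ∉ S := fun h => ha (mem_powerset.1 hS h)
  simp only [walsh, prod_insert haS, prod_singleton]
  ring

lemma expect_walshSum_sq (T : Finset (Fin n)) (c : Finset (Fin n) → ℝ) :
    𝔼 x, walshSum T c x ^ 2 = ∑ S ∈ T.powerset, c S ^ 2 := by
  induction T using Finset.induction_on generalizing c with
  | empty => simp [walshSum, walsh]
  | insert a T ha ih =>
    rw [sum_powerset_insert ha, ← ih c, ← ih fun S => c (insert a S)]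
    set r := walshSum T c
    set h := walshSum T fun S => c (insert a S)
    have hcross : 𝔼 x, walsh {a} x * (2 * r x * h x) = 0 :=
      expect_walsh_singleton_mul fun x => by
        simp only [r, h, walshSum_flipAt ha]
    have hexp : ∀ x, walshSum (insert a T) c x ^ 2 =
        r x ^ 2 + h x ^ 2 + walsh {a} x * (2 * r x * h x) := fun x => by
      rw [walshSum_insert ha]
      linear_combination h x ^ 2 * walsh_singleton_sq a x
    simp only [hexp, expect_add_distrib, hcross, add_zero]

/-- Bonami's lemma: a Walsh polynomial of degree at most `k` has fourth moment at most `9 ^ k`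
times the square of its second moment. -/
lemma expect_walshSum_pow_four_le (T : Finset (Fin n)) (c : Finset (Fin n) → ℝ) (k : ℕ)
    (hc : ∀ S, k < S.card → c S = 0) :
    𝔼 x, walshSum T c x ^ 4 ≤ 9 ^ k * (∑ S ∈ T.powerset, c S ^ 2) ^ 2 := by
  induction T using Finset.induction_on generalizing c k with
  | empty =>
    have : 1 ≤ (9 : ℝ) ^ k := one_le_pow₀ (by norm_num)
    have h4 : 0 ≤ c ∅ ^ 4 := by positivity
    simp only [walshSum, powerset_empty, sum_singleton, walsh, prod_empty, mul_one,
      Fintype.expect_const]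
    nlinarith
  | insert a T ha ih =>
    rw [sum_powerset_insert ha]
    have ihr := ih c k hc
    set r := walshSum T c
    set h := walshSum T fun S => c (insert a S)
    set R := ∑ S ∈ T.powerset, c S ^ 2
    set H := ∑ S ∈ T.powerset, c (insert a S) ^ 2
    have hR : 0 ≤ R := sum_nonneg fun _ _ => sq_nonneg _
    have hH : 0 ≤ H := sum_nonneg fun _ _ => sq_nonneg _
    have hcross : 𝔼 x, walsh {a} x * (4 * r x ^ 3 * h x + 4 * r x * h x ^ 3) = 0 :=
      expect_walsh_singleton_mul fun x => by
        simp only [r, h, walshSum_flipAt ha]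
    have hexp : ∀ x, walshSum (insert a T) c x ^ 4 =
        r x ^ 4 + 6 * (r x ^ 2 * h x ^ 2) + h x ^ 4 +
          walsh {a} x * (4 * r x ^ 3 * h x + 4 * r x * h x ^ 3) := fun x => by
      rw [walshSum_insert ha]
      linear_combination (6 * r x ^ 2 * h x ^ 2 + 4 * walsh {a} x * r x * h x ^ 3 +
        h x ^ 4 * (walsh {a} x ^ 2 + 1)) * walsh_singleton_sq a x
    simp only [hexp, expect_add_distrib, hcross, add_zero, ← mul_expect]
    cases k with
    | zero =>
      have hzero : ∀ S, c (insert a S) = 0 := fun S =>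
        hc _ (card_pos.2 (insert_nonempty _ _))
      have hh : ∀ x, h x = 0 := fun x => by simp [h, walshSum, hzero]
      have hH0 : H = 0 := by simp [H, hzero]
      simpa [hh, hH0] using ihr
    | succ k =>
      have ihh : 𝔼 x, h x ^ 4 ≤ 9 ^ k * H ^ 2 := by
        let c' : Finset (Fin n) → ℝ := fun S => if a ∈ S then 0 else c (insert a S)
        have hcc : ∀ S ∈ T.powerset, c' S = c (insert a S) := fun S hS =>
          if_neg fun h => ha (mem_powerset.1 hS h)
        have key := ih c' k fun S hS => by
          by_cases haS : a ∈ S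
          · simp [c', haS]
          · simp only [c', haS, if_false]
            exact hc _ (by rw [card_insert_of_notMem haS]; omega)
        have hh : ∀ x, walshSum T c' x = h x := fun x =>
          sum_congr rfl fun S hS => by rw [hcc S hS]
        have hH' : ∑ S ∈ T.powerset, c' S ^ 2 = H :=
          sum_congr rfl fun S hS => by rw [hcc S hS]
        simpa only [hh, hH'] using key
      have hmix : 𝔼 x, r x ^ 2 * h x ^ 2 ≤ 3 * 9 ^ k * (R * H) := by
        have hcs : (𝔼 x, r x ^ 2 * h x ^ 2) ^ 2 ≤
            (𝔼 x, (r x ^ 2) ^ 2) * 𝔼 x, (h x ^ 2) ^ 2 :=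
          expect_mul_sq_le_sq_mul_sq _ _ _
        simp only [← pow_mul] at hcs
        refine le_of_sq_le_sq ?_ (by positivity)
        calc _ ≤ _ := hcs
          _ ≤ (9 ^ (k + 1) * R ^ 2) * (9 ^ k * H ^ 2) := by
            exact mul_le_mul ihr ihh
              (expect_nonneg fun x _ => (even_two_mul 2).pow_nonneg _) (by positivity)
          _ = _ := by ring
      have h9 : (0 : ℝ) < 9 ^ k := by positivity
      have hHH : 0 ≤ 9 ^ k * H ^ 2 := by positivity
      rw [pow_succ] at ihr ⊢
      nlinarith

lemma expect_sq_le_of_expect_pow_four_le {g : (Fin n → Bool) → ℝ} {K : ℝ} (hK : 0 ≤ K)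
    (h4 : 𝔼 x, g x ^ 4 ≤ K * (𝔼 x, g x ^ 2) ^ 2) :
    𝔼 x, g x ^ 2 ≤ K * (𝔼 x, |g x|) ^ 2 := by
  set A := 𝔼 x, g x ^ 2
  set B := 𝔼 x, |g x|
  have hA : 0 ≤ A := expect_nonneg fun x _ => by positivity
  have h1 : A ^ 2 ≤ B * 𝔼 x, |g x| ^ 3 := by
    have := expect_mul_sq_le_sq_mul_sq univ (fun x => √|g x|) (fun x => √|g x| ^ 3)
    have e1 : ∀ x, √|g x| * √|g x| ^ 3 = g x ^ 2 := fun x => by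
      rw [← sq_abs (g x), ← pow_succ', show 3 + 1 = 2 * 2 from rfl, pow_mul,
        Real.sq_sqrt (abs_nonneg _)]
    have e2 : ∀ x, √|g x| ^ 2 = |g x| := fun x => Real.sq_sqrt (abs_nonneg _)
    have e3 : ∀ x, (√|g x| ^ 3) ^ 2 = |g x| ^ 3 := fun x => by rw [pow_right_comm, e2]
    simpa only [e1, e2, e3] using this
  have h2 : (𝔼 x, |g x| ^ 3) ^ 2 ≤ A * 𝔼 x, g x ^ 4 := by
    have := expect_mul_sq_le_sq_mul_sq univ (fun x => |g x|) (fun x => |g x| ^ 2)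
    have e1 : ∀ x, |g x| * |g x| ^ 2 = |g x| ^ 3 := fun x => by ring
    have e2 : ∀ x, (g x ^ 2) ^ 2 = g x ^ 4 := fun x => by ring
    simp only [e1] at this
    simpa only [sq_abs, e2] using this
  have h3 : A ^ 3 * A ≤ A ^ 3 * (K * B ^ 2) := by
    calc A ^ 3 * A = (A ^ 2) ^ 2 := by ring
      _ ≤ (B * 𝔼 x, |g x| ^ 3) ^ 2 := by gcongr
      _ = B ^ 2 * (𝔼 x, |g x| ^ 3) ^ 2 := by ring
      _ ≤ B ^ 2 * (A * (K * A ^ 2)) := by gcongr; exact h2.trans (by gcongr)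
      _ = A ^ 3 * (K * B ^ 2) := by ring
  rcases hA.eq_or_lt with h0 | hpos
  · rw [← h0]
    positivity
  · exact le_of_mul_le_mul_left h3 (by positivity)

end CubeExpectation

section MultilinearExtension

open Polynomial

variable {n : ℕ}

lemma sum_prod_one_add_sign_mul (y : Fin n → ℝ) :
    ∑ x : Fin n → Bool, ∏ k, (1 + (if x k then (1 : ℝ) else -1) * y k) = 2 ^ n := by
  have h := (prod_univ_sum (fun _ : Fin n => (univ : Finset Bool))
    (fun k b => 1 + (if b then (1 : ℝ) else -1) * y k))
  rw [Fintype.piFinset_univ] at h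
  rw [← h]
  have : ∀ k, ∑ b : Bool, (1 + (if b then (1 : ℝ) else -1) * y k) = 2 := fun k => by
    rw [Fintype.sum_bool, if_pos rfl, if_neg Bool.false_ne_true]
    ring
  simp only [this, prod_const, card_univ, Fintype.card_fin]

/-- The multilinear extension of a function with values in `[-1, 1]` is bounded by one on the
solid cube. -/
lemma abs_sum_walshCoeff_mul_prod_le_one {f : (Fin n → Bool) → ℝ} (hf : ∀ x, |f x| ≤ 1)
    {y : Fin n → ℝ} (hy : ∀ k, |y k| ≤ 1) :
    |∑ S, walshCoeff f S * ∏ k ∈ S, y k| ≤ 1 := by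
  have hrep : ∑ S, walshCoeff f S * ∏ k ∈ S, y k =
      (∑ x, f x * ∏ k, (1 + (if x k then (1 : ℝ) else -1) * y k)) / 2 ^ n := by
    simp only [prod_one_add, powerset_univ, walshCoeff, walsh, prod_mul_distrib, mul_sum, sum_mul,
      sum_div]
    rw [sum_comm]
    refine sum_congr rfl fun x _ => sum_congr rfl fun S _ => by ring
  rw [hrep, abs_div, abs_of_pos (by positivity : (0 : ℝ) < 2 ^ n), div_le_one (by positivity),
    ← sum_prod_one_add_sign_mul y]
  refine (abs_sum_le_sum_abs _ _).trans (sum_le_sum fun x _ => ?_)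
  have hnn : 0 ≤ ∏ k, (1 + (if x k then (1 : ℝ) else -1) * y k) := prod_nonneg fun k _ => by
    have := abs_le.1 (hy k)
    split_ifs <;> linarith
  rw [abs_mul, abs_of_nonneg hnn]
  exact mul_le_of_le_one_left hnn (hf x)

/-- The Fourier–Walsh expansion of `f` restricted to the sets containing `j`, that is
`x ↦ x_j ∂_j f(x)`. -/
noncomputable def laplacianAt (j : Fin n) (f : (Fin n → Bool) → ℝ) : (Fin n → Bool) → ℝ :=
  walshSum univ fun S => if j ∈ S then walshCoeff f S else 0

lemma expect_laplacianAt_sq (j : Fin n) (f : (Fin n → Bool) → ℝ) :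
    𝔼 x, laplacianAt j f x ^ 2 = influence j f := by
  rw [laplacianAt, expect_walshSum_sq, powerset_univ, influence, sum_filter]
  exact sum_congr rfl fun S _ => by split_ifs <;> simp

/-- Markov's inequality at the endpoint of `[-1, 1]`. -/
lemma abs_eval_derivative_one_le {d : ℕ} {P : ℝ[X]} (hdeg : P.degree ≤ d)
    (hP : ∀ t ∈ Set.Icc (-1 : ℝ) 1, |P.eval t| ≤ 1) : |(derivative P).eval 1| ≤ (d : ℝ) ^ 2 := by
  have upper : ∀ Q : ℝ[X], Q.degree ≤ d → (∀ t ∈ Set.Icc (-1 : ℝ) 1, |Q.eval t| ≤ 1) →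
      (derivative Q).eval 1 ≤ (d : ℝ) ^ 2 := fun Q hQd hQ => by
    simpa [Chebyshev.derivative_T_eval_one] using
      Chebyshev.eval_iterate_derivative_le_of_forall_abs_le_one (k := 1) le_rfl hQd hQ
  have hneg := upper (-P) (by rwa [degree_neg]) (by simpa using hP)
  rw [derivative_neg, eval_neg] at hneg
  exact abs_le.2 ⟨by linarith, upper P hdeg hP⟩

lemma abs_sum_laplacianAt_le {d : ℕ} {f : (Fin n → Bool) → ℝ} (hf : ∀ x, |f x| ≤ 1)
    (hdeg : ∀ S : Finset (Fin n), d < S.card → walshCoeff f S = 0)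
    (A : Finset (Fin n)) (x : Fin n → Bool) :
    |∑ j ∈ A, laplacianAt j f x| ≤ (d : ℝ) ^ 2 := by
  let P : ℝ[X] := ∑ S : Finset (Fin n), C (walshCoeff f S * walsh S x) * X ^ (S ∩ A).card
  have hPdeg : P.degree ≤ d := by
    refine (degree_sum_le _ _).trans (Finset.sup_le fun S _ => ?_)
    by_cases hS : d < S.card
    · simp [hdeg S hS]
    · refine (degree_C_mul_X_pow_le _ _).trans ?_
      exact_mod_cast (card_le_card inter_subset_left).trans (not_lt.1 hS)
  have hPbd : ∀ t ∈ Set.Icc (-1 : ℝ) 1, |P.eval t| ≤ 1 := fun t ht => by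
    have h := abs_sum_walshCoeff_mul_prod_le_one hf
      (y := fun k => (if x k then (1 : ℝ) else -1) * if k ∈ A then t else 1) fun k => by
        have := abs_le.2 ht
        split_ifs <;> simp [this]
    convert h using 2
    simp only [P, eval_finsetSum, eval_mul, eval_C, eval_pow, eval_X]
    refine sum_congr rfl fun S _ => ?_
    rw [prod_mul_distrib, prod_ite_mem, prod_const, walsh, mul_assoc]
  have hder : (derivative P).eval 1 = ∑ j ∈ A, laplacianAt j f x := by
    simp only [P, derivative_sum, eval_finsetSum, derivative_C_mul_X_pow, laplacianAt, walshSum,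
      powerset_univ]
    rw [sum_comm]
    refine sum_congr rfl fun S _ => ?_
    simp only [eval_mul, eval_C, eval_pow, eval_X, one_pow, mul_one, ite_mul, zero_mul]
    rw [sum_ite_mem, sum_const, inter_comm, nsmul_eq_mul, mul_comm]
  rw [← hder]
  exact abs_eval_derivative_one_le hPdeg hPbd

lemma sum_abs_laplacianAt_le {d : ℕ} {f : (Fin n → Bool) → ℝ} (hf : ∀ x, |f x| ≤ 1)
    (hdeg : ∀ S : Finset (Fin n), d < S.card → walshCoeff f S = 0) (x : Fin n → Bool) :
    ∑ j, |laplacianAt j f x| ≤ 2 * (d : ℝ) ^ 2 := by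
  rw [← sum_filter_add_sum_filter_not univ fun j => 0 ≤ laplacianAt j f x,
    sum_congr rfl fun j hj => abs_of_nonneg (mem_filter.1 hj).2,
    sum_congr (s₁ := univ.filter fun j => ¬0 ≤ laplacianAt j f x) rfl
      fun j hj => abs_of_neg (not_le.1 (mem_filter.1 hj).2), sum_neg_distrib]
  have h1 := abs_le.1
    (abs_sum_laplacianAt_le hf hdeg (univ.filter fun j => 0 ≤ laplacianAt j f x) x)
  have h2 := abs_le.1
    (abs_sum_laplacianAt_le hf hdeg (univ.filter fun j => ¬0 ≤ laplacianAt j f x) x)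
  linarith

end MultilinearExtension

section Influences

variable {n : ℕ}

lemma influence_nonneg (j : Fin n) (f : (Fin n → Bool) → ℝ) : 0 ≤ influence j f :=
  sum_nonneg fun _ _ => sq_nonneg _

lemma variance_nonneg (f : (Fin n → Bool) → ℝ) : 0 ≤ variance f :=
  sum_nonneg fun _ _ => sq_nonneg _

/-- The Poincaré inequality on the cube. -/
lemma variance_le_sum_influence (f : (Fin n → Bool) → ℝ) :
    variance f ≤ ∑ j, influence j f := by
  simp only [variance, influence, sum_filter]
  rw [sum_comm]
  refine sum_le_sum fun S _ => ?_
  rw [sum_ite_mem, univ_inter, sum_const, nsmul_eq_mul]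
  split_ifs with hS
  · have : (1 : ℝ) ≤ S.card := by exact_mod_cast card_pos.2 (nonempty_iff_ne_empty.2 hS)
    exact le_mul_of_one_le_left (sq_nonneg _) this
  · positivity

/-- The `L²`–`L¹` comparison for the discrete derivatives of a function of degree at most `d`. -/
lemma sqrt_influence_le {d : ℕ} {f : (Fin n → Bool) → ℝ}
    (hdeg : ∀ S : Finset (Fin n), d < S.card → walshCoeff f S = 0) (j : Fin n) :
    √(influence j f) ≤ 3 ^ d * 𝔼 x, |laplacianAt j f x| := by
  refine Real.sqrt_le_iff.2
    ⟨mul_nonneg (by positivity) (expect_nonneg fun x _ => abs_nonneg _), ?_⟩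
  have h4 : 𝔼 x, laplacianAt j f x ^ 4 ≤ 9 ^ d * (𝔼 x, laplacianAt j f x ^ 2) ^ 2 := by
    rw [laplacianAt, expect_walshSum_sq]
    exact expect_walshSum_pow_four_le _ _ _ fun S hS => by simp [hdeg S hS]
  rw [← expect_laplacianAt_sq, mul_pow, pow_right_comm]
  norm_num only
  exact expect_sq_le_of_expect_pow_four_le (by positivity) h4

lemma variance_le_of_influence_le {d : ℕ} {f : (Fin n → Bool) → ℝ} (hf : ∀ x, |f x| ≤ 1)
    (hdeg : ∀ S : Finset (Fin n), d < S.card → walshCoeff f S = 0) {M : ℝ}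
    (hM : ∀ j, influence j f ≤ M) :
    variance f ≤ √M * (3 ^ d * (2 * (d : ℝ) ^ 2)) := by
  calc variance f ≤ ∑ j, influence j f := variance_le_sum_influence f
    _ ≤ ∑ j, √M * (3 ^ d * 𝔼 x, |laplacianAt j f x|) := by
      refine sum_le_sum fun j _ => ?_
      rw [← Real.mul_self_sqrt (influence_nonneg j f)]
      exact mul_le_mul (Real.sqrt_le_sqrt (hM j)) (sqrt_influence_le hdeg j)
        (Real.sqrt_nonneg _) (Real.sqrt_nonneg _)
    _ = √M * (3 ^ d * 𝔼 x, ∑ j, |laplacianAt j f x|) := by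
      rw [expect_sum_comm, mul_sum, mul_sum]
    _ ≤ √M * (3 ^ d * (2 * (d : ℝ) ^ 2)) := by
      gcongr
      exact expect_le univ_nonempty fun x _ => sum_abs_laplacianAt_le hf hdeg x

lemma four_mul_nine_pow_le_exp {d : ℕ} (hd : d ≠ 0) : 4 * (9 : ℝ) ^ d ≤ Real.exp (4 * d) := by
  have he : (36 : ℝ) ≤ Real.exp 4 := by
    have h := Real.exp_one_gt_d9
    calc (36 : ℝ) ≤ 2.7 ^ 4 := by norm_num
      _ ≤ Real.exp 1 ^ 4 := by gcongr; linarith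
      _ = Real.exp 4 := by rw [← Real.exp_nat_mul]; norm_num
  calc 4 * (9 : ℝ) ^ d ≤ 4 ^ d * 9 ^ d := by
        gcongr
        exact le_self_pow₀ (by norm_num) hd
    _ = 36 ^ d := by rw [← mul_pow]; norm_num
    _ ≤ Real.exp 4 ^ d := by gcongr
    _ = Real.exp (4 * d) := by rw [← Real.exp_nat_mul, mul_comm]

end Influences

/-- Weak Aaronson–Ambainis bound: a non-constant function `f : {-1,1}^n → [-1,1]` of degree at
most `d` satisfies `Var(f)² ≤ d⁴ e^{4d} max_j Inf_j(f)`, equivalently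
`Var(f)² / max_j Inf_j(f) ≤ d⁴ e^{4d}`. -/
theorem aaronson_ambainis_exponential (d n : ℕ) (hn : 0 < n)
    (f : (Fin n → Bool) → ℝ)
    (hrange : ∀ x, f x ∈ Set.Icc (-1 : ℝ) 1)
    (hdeg : ∀ S : Finset (Fin n), d < S.card → walshCoeff f S = 0)
    (hnc : ∃ x y, f x ≠ f y) :
    variance f ^ 2 ≤ (d : ℝ) ^ 4 * Real.exp (4 * d) * ⨆ j : Fin n, influence j f ∧
    variance f ^ 2 / (⨆ j : Fin n, influence j f) ≤ (d : ℝ) ^ 4 * Real.exp (4 * d) := by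
  have hf : ∀ x, |f x| ≤ 1 := fun x => abs_le.2 (hrange x)
  set M := ⨆ j : Fin n, influence j f
  have hM : ∀ j, influence j f ≤ M :=
    le_ciSup (f := fun j => influence j f) (Set.finite_range _).bddAbove
  have hM0 : 0 ≤ M := Real.iSup_nonneg fun j => influence_nonneg j f
  have main : variance f ^ 2 ≤ (d : ℝ) ^ 4 * Real.exp (4 * d) * M := by
    calc variance f ^ 2 ≤ (√M * (3 ^ d * (2 * (d : ℝ) ^ 2))) ^ 2 :=
          pow_le_pow_left₀ (variance_nonneg f) (variance_le_of_influence_le hf hdeg hM) 2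
      _ = (d : ℝ) ^ 4 * (4 * 9 ^ d) * M := by
        rw [mul_pow, Real.sq_sqrt hM0, mul_pow, pow_right_comm]
        norm_num only
        ring
      _ ≤ (d : ℝ) ^ 4 * Real.exp (4 * d) * M := by
        rcases eq_or_ne d 0 with rfl | hd
        · simp
        · gcongr
          exact four_mul_nine_pow_le_exp hd
  exact ⟨main, div_le_of_le_mul₀ hM0 (by positivity) main⟩
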